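/- Let X be a spectral space such that every maximal point of X lies in the patch closure of the set X^min of minimal points. The following are equivalent: (a) X is Boolean (compact, Hausdorff, and zero-dimensional, i.e. the specialization order is trivial); (b) qcop(X) is a Stone algebra; (c) X is an Esakia space; (d) X is a PC-space; (e) X^min is patch closed. -/

import Mathlib

open Set Topology

namespace PCF

variable {X : Type*}

/-- The compact open subsets of a topological space. -/
def qcop (t : TopologicalSpace X) : Set (Set X) :=
  {U | @IsOpen X t U ∧ @IsCompact X t U}

/-- The complements of the compact open subsets. -/
def qccl (t : TopologicalSpace X) : Set (Set X) :=
  {C | ∃ U ∈ qcop t, C = Uᶜ}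

/-- The Boolean algebra of subsets generated by the compact open sets:
the constructible sets. -/
def Constructible (t : TopologicalSpace X) : Set (Set X) :=
  ⋂₀ {B : Set (Set X) | qcop t ⊆ B ∧ (∀ s ∈ B, sᶜ ∈ B) ∧
        (∀ s ∈ B, ∀ u ∈ B, s ∪ u ∈ B) ∧ (∅ : Set X) ∈ B}

/-- The patch topology: generated by the compact open sets together with their
complements (equivalently, by the constructible sets). -/
def patchTop (t : TopologicalSpace X) : TopologicalSpace X :=
  TopologicalSpace.generateFrom (qcop t ∪ qccl t)

/-- The inverse topology, with the complements of compact opens as a basis of opens. -/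
def invTop (t : TopologicalSpace X) : TopologicalSpace X :=
  TopologicalSpace.generateFrom (qccl t)

/-- The specialization order: `x ≤ y` iff `y` is in the closure of `{x}`. -/
def specLE (t : TopologicalSpace X) (x y : X) : Prop := y ∈ @closure X t {x}

/-- Minimal points for the specialization order. -/
def minPts (t : TopologicalSpace X) : Set X := {x | ∀ y, specLE t y x → y = x}

/-- Maximal points for the specialization order. -/
def maxPts (t : TopologicalSpace X) : Set X := {x | ∀ y, specLE t x y → y = x}

/-- Minimal points of a subset `S`, for the induced specialization order. -/
def minPtsIn (t : TopologicalSpace X) (S : Set X) : Set X :=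
  {x | x ∈ S ∧ ∀ y ∈ S, specLE t y x → y = x}

/-- Maximal points of a subset `S`, for the induced specialization order. -/
def maxPtsIn (t : TopologicalSpace X) (S : Set X) : Set X :=
  {x | x ∈ S ∧ ∀ y ∈ S, specLE t x y → y = x}

/-- The down-set (set of generalizations) generated by `S`. -/
def downset (t : TopologicalSpace X) (S : Set X) : Set X :=
  {x | ∃ s ∈ S, specLE t x s}

/-- The up-set (set of specializations) generated by `S`. -/
def upset (t : TopologicalSpace X) (S : Set X) : Set X :=
  {x | ∃ s ∈ S, specLE t s x}

/-- A topology is spectral if the space is compact, sober (quasi-sober and T0),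
the compact opens form a basis, and the compact opens are closed under
finite intersections. -/
def IsSpectral (t : TopologicalSpace X) : Prop :=
  @CompactSpace X t ∧ @QuasiSober X t ∧ @T0Space X t ∧
  @TopologicalSpace.IsTopologicalBasis X t (qcop t) ∧
  ∀ U ∈ qcop t, ∀ V ∈ qcop t, U ∩ V ∈ qcop t

/-- A Boolean space: compact, Hausdorff and zero-dimensional. -/
def IsBooleanSpace (t : TopologicalSpace X) : Prop :=
  @CompactSpace X t ∧ @T2Space X t ∧
  @TopologicalSpace.IsTopologicalBasis X t {U | @IsClopen X t U}

/-- `V` is the pseudocomplement of `U` in the lattice of sets `L` (ordered by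
inclusion, with meet given by intersection and bottom element `∅`): `V` is the
largest element of `L` disjoint from `U`. -/
def IsPseudoCompl (L : Set (Set X)) (U V : Set X) : Prop :=
  V ∈ L ∧ U ∩ V = ∅ ∧ ∀ W ∈ L, U ∩ W = ∅ → W ⊆ V

/-- The lattice of sets `L` is pseudocomplemented: every element has a
pseudocomplement. -/
def Pseudocomplemented (L : Set (Set X)) : Prop :=
  ∀ U ∈ L, ∃ V, IsPseudoCompl L U V

/-- The lattice of sets `L` is a Stone algebra: it is pseudocomplemented and
`U* ∪ U** = ⊤` for every `U`. -/
def StoneAlgebra (L : Set (Set X)) : Prop :=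
  Pseudocomplemented L ∧
  ∀ U ∈ L, ∀ V W : Set X, IsPseudoCompl L U V → IsPseudoCompl L V W → V ∪ W = univ

/-- The lattice of sets `L` is a Heyting algebra: for all `U, V ∈ L` there is a
largest `W ∈ L` with `U ∩ W ⊆ V`. -/
def HeytingAlg (L : Set (Set X)) : Prop :=
  ∀ U ∈ L, ∀ V ∈ L, ∃ W ∈ L, U ∩ W ⊆ V ∧ ∀ W' ∈ L, U ∩ W' ⊆ V → W' ⊆ W

/-- A PC-space: the lattice of compact open sets is pseudocomplemented. -/
def IsPCSpace (t : TopologicalSpace X) : Prop := Pseudocomplemented (qcop t)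

/-- An Esakia space: the closure of every constructible set is constructible. -/
def IsEsakia (t : TopologicalSpace X) : Prop :=
  ∀ S ∈ Constructible t, @closure X t S ∈ Constructible t

/-- A spectral root system: the closure of every point is a specialization chain. -/
def IsRootSystem (t : TopologicalSpace X) : Prop :=
  ∀ x : X, IsChain (specLE t) (@closure X t {x})

/-- A spectral forest: the inverse space is a spectral root system. -/
def IsForest (t : TopologicalSpace X) : Prop := IsRootSystem (invTop t)

/-- A stranded space: the specialization poset is a disjoint union of chains, i.e.
the set of points comparable with any fixed point is a chain. -/
def Stranded (t : TopologicalSpace X) : Prop :=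
  ∀ x : X, IsChain (specLE t) {y | specLE t x y ∨ specLE t y x}

end PCF

open PCF

section Rings

variable (T : Type*) [TopologicalSpace T]

/-- The zero set of a continuous real-valued function. -/
def zeroSet (f : ContinuousMap T ℝ) : Set T := {t | f t = 0}

/-- The lattice of cozero sets of a topological space. -/
def Coz : Set (Set T) := {U | ∃ f : ContinuousMap T ℝ, U = {t | f t ≠ 0}}

/-- A z-ideal of the ring `C(T)` of continuous real-valued functions. -/
def IsZIdeal (I : Ideal (ContinuousMap T ℝ)) : Prop :=
  ∀ f ∈ I, ∀ g : ContinuousMap T ℝ, zeroSet T f ⊆ zeroSet T g → g ∈ I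

/-- The prime z-ideals, as a subset of the prime spectrum of `C(T)`. -/
def zSpec : Set (PrimeSpectrum (ContinuousMap T ℝ)) :=
  {p | IsZIdeal T p.asIdeal}

/-- A space is basically disconnected if the closure of every cozero set is open. -/
def BasicallyDisconnected : Prop :=
  ∀ f : ContinuousMap T ℝ, IsOpen (closure {t | f t ≠ 0})

/-- The Zariski topology on the prime spectrum of `C(T)`. -/
def specTop : TopologicalSpace (PrimeSpectrum (ContinuousMap T ℝ)) := inferInstance

/-- The subspace topology on the set of prime z-ideals. -/
def zTop : TopologicalSpace ↥(zSpec T) := inferInstance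

end Rings

/-- The subspace topology on a subset. -/
def subTop {Y : Type*} [TopologicalSpace Y] (X : Set Y) : TopologicalSpace ↥X :=
  inferInstance

section SpectralLemmas

variable {X : Type*} [t : TopologicalSpace X]

theorem specLE_iff_specializes {x y : X} : specLE t x y ↔ x ⤳ y :=
  specializes_iff_mem_closure.symm

theorem PCF.IsSpectral.spectralSpace (hX : IsSpectral t) : SpectralSpace X := by
  obtain ⟨_, _, _, hbasis, hinter⟩ := hX
  have : PrespectralSpace X := ⟨hbasis⟩
  have : QuasiSeparatedSpace X :=
    ⟨fun U V hU hUc hV hVc ↦ (hinter U ⟨hU, hUc⟩ V ⟨hV, hVc⟩).2⟩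
  exact {}

theorem patchTop_eq_constructibleTopology : patchTop t = constructibleTopology X := by
  unfold patchTop constructibleTopology constructibleTopologySubbasis
  congr 2
  ext C
  constructor
  · rintro ⟨U, ⟨hU, hUc⟩, rfl⟩
    exact ⟨hU.isClosed_compl, by rwa [compl_compl]⟩
  · rintro ⟨hC, hCc⟩
    exact ⟨Cᶜ, ⟨hC.isOpen_compl, hCc⟩, (compl_compl C).symm⟩

theorem compactSpace_patchTop [SpectralSpace X] : @CompactSpace X (patchTop t) := by
  rw [patchTop_eq_constructibleTopology]
  exact @Function.Surjective.compactSpace (WithConstructibleTopology X) X _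
    (constructibleTopology X) _ (WithTopology.continuous_ofTopology _)
    compactSpace_withConstructibleTopology (WithTopology.ofTopology_surjective _)

theorem patchTop_le [PrespectralSpace X] : patchTop t ≤ t := by
  conv_rhs => rw [(PrespectralSpace.isTopologicalBasis (X := X)).eq_generateFrom]
  exact TopologicalSpace.generateFrom_anti subset_union_left

theorem isClopen_patchTop_of_mem_qcop {U : Set X} (hU : U ∈ qcop t) :
    @IsClopen X (patchTop t) U := by
  refine ⟨(@isOpen_compl_iff X U (patchTop t)).1 ?_, ?_⟩
  · exact TopologicalSpace.isOpen_generateFrom_of_mem (.inr ⟨U, hU, rfl⟩)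
  · exact TopologicalSpace.isOpen_generateFrom_of_mem (.inl hU)

theorem isCompact_of_isClosed_patchTop [SpectralSpace X] {K : Set X}
    (hK : IsClosed[patchTop t] K) : IsCompact K := by
  have hKc : @IsCompact X (patchTop t) K :=
    @IsClosed.isCompact X (patchTop t) K compactSpace_patchTop hK
  simpa using @IsCompact.image X X (patchTop t) t K id hKc (continuous_id_iff_le.2 patchTop_le)

/-- If every compact open neighbourhood of `x` meets the compact open set `U`, then `x` has a
generalization in `U`. -/
theorem exists_specializes_of_forall_inter_nonempty [SpectralSpace X] {U : Set X}
    (hU : U ∈ qcop t) {x : X} (h : ∀ V ∈ qcop t, x ∈ V → (U ∩ V).Nonempty) :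
    ∃ y ∈ U, y ⤳ x := by
  have hbasis : TopologicalSpace.IsTopologicalBasis (qcop t) := PrespectralSpace.isTopologicalBasis
  have hKc : @IsCompact X (patchTop t) U :=
    @IsClosed.isCompact X (patchTop t) U compactSpace_patchTop
      (@IsClopen.isClosed X (patchTop t) U (isClopen_patchTop_of_mem_qcop hU))
  obtain ⟨y, hyU, hy⟩ := @IsCompact.inter_iInter_nonempty X (patchTop t) U
    {V : Set X // V ∈ qcop t ∧ x ∈ V} hKc (fun V ↦ V)
    (fun V ↦ @IsClopen.isClosed X (patchTop t) _ (isClopen_patchTop_of_mem_qcop V.2.1))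
    (fun u ↦ by
      obtain ⟨W, hW, hxW, hWu⟩ := hbasis.exists_subset_of_mem_open
        (u := ⋂ V ∈ u, (V : Set X)) (mem_iInter₂.2 fun V _ ↦ V.2.2)
        (u.finite_toSet.isOpen_biInter fun V _ ↦ V.2.1.1)
      exact (h W hW hxW).mono (inter_subset_inter_right _ hWu))
  refine ⟨y, hyU, specializes_iff_forall_open.2 fun O hO hxO ↦ ?_⟩
  obtain ⟨W, hW, hxW, hWO⟩ := hbasis.exists_subset_of_mem_open hxO hO
  exact hWO (mem_iInter.1 hy ⟨W, hW, hxW⟩)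

theorem exists_mem_maxPts_specializes [T0Space X] [CompactSpace X] (x : X) :
    ∃ m ∈ maxPts t, x ⤳ m := by
  obtain ⟨m, hm, hmc⟩ := isClosed_closure.exists_closed_singleton
    (S := closure {x}) (closure_nonempty_iff.2 (singleton_nonempty x))
  refine ⟨m, fun y hy ↦ ?_, specializes_iff_mem_closure.2 hm⟩
  rwa [specLE, hmc.closure_eq] at hy

theorem mem_minPts_iff [SpectralSpace X] {x : X} :
    x ∈ minPts t ↔ ∀ U ∈ qcop t, x ∈ U ∨ ∃ V ∈ qcop t, x ∈ V ∧ U ∩ V = ∅ := by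
  have hbasis : TopologicalSpace.IsTopologicalBasis (qcop t) := PrespectralSpace.isTopologicalBasis
  constructor
  · intro hx U hU
    by_contra! hcon
    obtain ⟨y, hyU, hyx⟩ := exists_specializes_of_forall_inter_nonempty hU hcon.2
    exact hcon.1 (hx y (specLE_iff_specializes.2 hyx) ▸ hyU)
  · intro hx y hy
    rw [specLE_iff_specializes] at hy
    refine (hy.antisymm (specializes_iff_forall_open.2 fun O hO hyO ↦ ?_)).eq
    obtain ⟨U, hU, hyU, hUO⟩ := hbasis.exists_subset_of_mem_open hyO hO
    refine hUO ((hx U hU).resolve_right ?_)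
    rintro ⟨V, hV, hxV, hUV⟩
    exact (hUV ▸ ⟨hyU, hy.mem_open hV.1 hxV⟩ : y ∈ (∅ : Set X))

theorem isClosed_patchTop_minPts_of_isPCSpace [SpectralSpace X] (h : IsPCSpace t) :
    IsClosed[patchTop t] (minPts t) := by
  choose! P hP using h
  have heq : minPts t = ⋂ U ∈ qcop t, U ∪ P U := by
    ext x
    rw [mem_minPts_iff, mem_iInter₂]
    refine forall₂_congr fun U hU ↦
      or_congr_right ⟨?_, fun hx ↦ ⟨P U, (hP U hU).1, hx, (hP U hU).2.1⟩⟩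
    rintro ⟨V, hV, hxV, hUV⟩
    exact (hP U hU).2.2 V hV hUV hxV
  rw [heq]
  exact @isClosed_biInter X _ (patchTop t) _ _ fun U hU ↦ @IsClopen.isClosed X (patchTop t) _
    (@IsClopen.union X (patchTop t) _ _ (isClopen_patchTop_of_mem_qcop hU)
      (isClopen_patchTop_of_mem_qcop (hP U hU).1))

theorem isClopen_of_mem_constructible {τ : TopologicalSpace X}
    (h : ∀ U ∈ qcop t, @IsClopen X τ U) {S : Set X} (hS : S ∈ Constructible t) :
    @IsClopen X τ S :=
  hS {S | @IsClopen X τ S}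
    ⟨h, fun _ hs ↦ hs.compl, fun _ hs _ hu ↦ hs.union hu, isClopen_empty⟩

theorem qcop_subset_constructible : qcop t ⊆ Constructible t :=
  fun _ hU _ hB ↦ hB.1 hU

theorem compl_mem_constructible {S : Set X} (hS : S ∈ Constructible t) :
    Sᶜ ∈ Constructible t :=
  fun B hB ↦ hB.2.1 S (hS B hB)

theorem isPCSpace_of_isEsakia [SpectralSpace X] (h : IsEsakia t) : IsPCSpace t := by
  intro U hU
  have hcons := compl_mem_constructible (h U (qcop_subset_constructible hU))
  have hclosed := @IsClopen.isClosed X (patchTop t) _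
    (isClopen_of_mem_constructible (fun V hV ↦ isClopen_patchTop_of_mem_qcop hV) hcons)
  refine ⟨(closure U)ᶜ, ⟨isClosed_closure.isOpen_compl, isCompact_of_isClosed_patchTop hclosed⟩,
    ?_, fun W hW hUW ↦ ?_⟩
  · exact (disjoint_compl_right_iff_subset.2 subset_closure).inter_eq
  · exact ((disjoint_iff_inter_eq_empty.2 hUW).closure_left hW.1).subset_compl_left

theorem isClopen_of_mem_qcop_of_forall_specializes_eq [SpectralSpace X]
    (h : ∀ x y : X, x ⤳ y → x = y) {U : Set X} (hU : U ∈ qcop t) : IsClopen U := by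
  refine ⟨⟨isOpen_iff_forall_mem_open.2 fun x hx ↦ ?_⟩, hU.1⟩
  by_contra! hcon
  obtain ⟨y, hyU, hyx⟩ := exists_specializes_of_forall_inter_nonempty hU (x := x) fun V hV hxV ↦ by
    rw [← not_disjoint_iff_nonempty_inter]
    exact fun hdisj ↦ hcon V hdisj.subset_compl_left hV.1 hxV
  exact hx (h y x hyx ▸ hyU)

theorem isBooleanSpace_of_forall_specializes_eq [SpectralSpace X]
    (h : ∀ x y : X, x ⤳ y → x = y) : IsBooleanSpace t := by
  have hbasis : TopologicalSpace.IsTopologicalBasis (qcop t) := PrespectralSpace.isTopologicalBasis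
  refine ⟨inferInstance, ⟨fun x y hxy ↦ ?_⟩, hbasis.of_isOpen_of_subset (fun _ hU ↦ hU.2)
    fun U hU ↦ isClopen_of_mem_qcop_of_forall_specializes_eq h hU⟩
  obtain ⟨O, hO, hxO, hyO⟩ : ∃ O, IsOpen O ∧ x ∈ O ∧ y ∉ O := by
    by_contra! hcon
    exact hxy (h y x (specializes_iff_forall_open.2 hcon)).symm
  obtain ⟨U, hU, hxU, hUO⟩ := hbasis.exists_subset_of_mem_open hxO hO
  exact ⟨U, Uᶜ, hU.1, (isClopen_of_mem_qcop_of_forall_specializes_eq h hU).compl.isOpen, hxU,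
    fun hyU ↦ hyO (hUO hyU), disjoint_compl_right⟩

theorem PCF.IsBooleanSpace.mem_qcop_iff (h : IsBooleanSpace t) {U : Set X} :
    U ∈ qcop t ↔ IsClopen U := by
  obtain ⟨_, _, -⟩ := h
  exact ⟨fun hU ↦ ⟨hU.2.isClosed, hU.1⟩, fun hU ↦ ⟨hU.isOpen, hU.isClosed.isCompact⟩⟩

theorem PCF.IsBooleanSpace.stoneAlgebra (h : IsBooleanSpace t) : StoneAlgebra (qcop t) := by
  have hcompl {U : Set X} (hU : U ∈ qcop t) : Uᶜ ∈ qcop t :=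
    h.mem_qcop_iff.2 (h.mem_qcop_iff.1 hU).compl
  refine ⟨fun U hU ↦ ⟨Uᶜ, hcompl hU, inter_compl_self U, fun W _ hUW ↦ ?_⟩,
    fun U _ V W hV hW ↦ ?_⟩
  · exact (disjoint_iff_inter_eq_empty.2 hUW).subset_compl_left
  · exact univ_subset_iff.1 ((union_compl_self V).ge.trans
      (union_subset_union_right V (hW.2.2 _ (hcompl hV.1) (inter_compl_self V))))

theorem PCF.IsBooleanSpace.isEsakia (h : IsBooleanSpace t) : IsEsakia t := fun S hS ↦ by
  rwa [(isClopen_of_mem_constructible (fun U hU ↦ h.mem_qcop_iff.1 hU) hS).isClosed.closure_eq]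

end SpectralLemmas

/-- For a spectral space `X` in which every maximal point lies in the patch
closure of `X^min`, TFAE: (a) `X` is Boolean; (b) `qcop X` is a Stone algebra; (c) `X`
is an Esakia space; (d) `X` is a PC-space; (e) `X^min` is patch closed. -/
theorem statement_6 {X : Type*} [t : TopologicalSpace X] (hX : IsSpectral t)
    (hmax : maxPts t ⊆ @closure X (patchTop t) (minPts t)) :
    List.TFAE
      [ IsBooleanSpace t,
        StoneAlgebra (qcop t),
        IsEsakia t,
        IsPCSpace t,
        IsClosed[patchTop t] (minPts t) ] := by
  have := hX.spectralSpace
  tfae_have 1 → 2 := fun h ↦ h.stoneAlgebra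
  tfae_have 1 → 3 := fun h ↦ h.isEsakia
  tfae_have 2 → 4 := fun h ↦ h.1
  tfae_have 3 → 4 := isPCSpace_of_isEsakia
  tfae_have 4 → 5 := isClosed_patchTop_minPts_of_isPCSpace
  tfae_have 5 → 1 := fun h ↦ by
    refine isBooleanSpace_of_forall_specializes_eq fun x y hxy ↦ ?_
    obtain ⟨m, hm, hym⟩ := exists_mem_maxPts_specializes y
    have hmin : m ∈ minPts t := @IsClosed.closure_eq X (patchTop t) _ h ▸ hmax hm
    rw [hmin y (specLE_iff_specializes.2 hym),
      hmin x (specLE_iff_specializes.2 (hxy.trans hym))]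
  tfae_finish
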